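/- Let n ≥ 1 and let i_0, …, i_n be integers with 0 ≤ i_k ≤ s_k − 1 for each k and ∑_{k=0}^{n} d_{n,k} i_k < d_n, let j be an index with i_j ≠ 0, and set w_j := (d_n − ∑_{k ≠ j} d_{n,k} i_k)/i_j. If ∑_{k ≠ j} d_{n,k} + w_j = d_n, then i_j = i_n and ∑_{k=0}^{n−1} d_{n−1,k} i_k + i_n = d_{n−1}. -/

import Mathlib

/-- The Sylvester sequence: `s 0 = 2`, `s (n+1) = 1 + s 0 * s 1 * ⋯ * s n`. -/
def syl : ℕ → ℕ
  | 0 => 2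
  | n + 1 => 1 + ∏ k ∈ (Finset.range (n + 1)).attach, syl k.1
decreasing_by exact Finset.mem_range.mp k.2

/-- `d n = ∏_{k=0}^{n} s k`. -/
def dS (n : ℕ) : ℕ := ∏ k ∈ Finset.range (n + 1), syl k

/-- `d⟨n,j⟩ = d n / s j`. -/
def dSj (n j : ℕ) : ℕ := dS n / syl j

theorem syl_succ (n : ℕ) : syl (n + 1) = 1 + dS n := by
  rw [syl, dS, Finset.prod_attach (Finset.range (n + 1)) syl]

theorem syl_pos (n : ℕ) : 0 < syl n := by
  cases n with
  | zero => simp [syl]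
  | succ n => rw [syl_succ]; omega

theorem dS_succ (n : ℕ) : dS (n + 1) = dS n * syl (n + 1) :=
  Finset.prod_range_succ _ _

theorem syl_dvd_dS {n k : ℕ} (hk : k ≤ n) : syl k ∣ dS n :=
  Finset.dvd_prod_of_mem _ (by simpa [Nat.lt_succ_iff] using hk)

theorem dS_pos (n : ℕ) : 0 < dS n :=
  Finset.prod_pos fun k _ => syl_pos k

theorem syl_mono : Monotone syl :=
  monotone_nat_of_le_succ fun n => by
    have := Nat.le_of_dvd (dS_pos n) (syl_dvd_dS le_rfl)
    rw [syl_succ]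
    omega

theorem dSj_succ {n k : ℕ} (hk : k ≤ n) : dSj (n + 1) k = syl (n + 1) * dSj n k := by
  rw [dSj, dSj, dS_succ, mul_comm, Nat.mul_div_assoc _ (syl_dvd_dS hk)]

theorem dSj_succ_self (n : ℕ) : dSj (n + 1) (n + 1) = dS n := by
  rw [dSj, dS_succ, Nat.mul_div_cancel _ (syl_pos _)]

theorem sum_dSj_succ_mul (n : ℕ) (f : ℕ → ℕ) :
    ∑ k ∈ Finset.range (n + 2), dSj (n + 1) k * f k =
      syl (n + 1) * ∑ k ∈ Finset.range (n + 1), dSj n k * f k + dS n * f (n + 1) := by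
  rw [Finset.sum_range_succ, dSj_succ_self, Finset.mul_sum]
  congr 1
  refine Finset.sum_congr rfl fun k hk => ?_
  rw [dSj_succ (Nat.lt_succ_iff.mp (Finset.mem_range.mp hk)), mul_assoc]

theorem sum_dSj_add_one (n : ℕ) : ∑ k ∈ Finset.range (n + 1), dSj n k + 1 = dS n := by
  induction n with
  | zero => simp [dSj, dS, syl]
  | succ n ih =>
    have h := sum_dSj_succ_mul n fun _ => 1
    simp only [mul_one] at h
    rw [h, dS_succ, ← ih, syl_succ, ← ih]
    ring

/-- The equality `∑_{k ≠ j} d_{n,k} + w_j = d_n`, cleared of its denominator. -/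
theorem sum_dSj_mul_add_eq {n j : ℕ} {i : ℕ → ℕ} (hj : j ≤ n) (hij : i j ≠ 0)
    (heq : (∑ k ∈ (Finset.range (n + 1)).erase j, (dSj n k : ℚ)) +
      ((dS n : ℚ) - ∑ k ∈ (Finset.range (n + 1)).erase j, (dSj n k : ℚ) * (i k : ℚ)) / (i j : ℚ)
        = (dS n : ℚ)) :
    ∑ k ∈ Finset.range (n + 1), dSj n k * i k + i j = dS n := by
  have hmem : j ∈ Finset.range (n + 1) := Finset.mem_range.mpr (Nat.lt_succ_of_le hj)
  have hd : (∑ k ∈ Finset.range (n + 1), (dSj n k : ℚ)) + 1 = dS n := by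
    exact_mod_cast sum_dSj_add_one n
  have hij' : (i j : ℚ) ≠ 0 := by exact_mod_cast hij
  have hw : ((dS n : ℚ) -
      ∑ k ∈ (Finset.range (n + 1)).erase j, (dSj n k : ℚ) * (i k : ℚ)) / (i j : ℚ) =
      dSj n j + 1 := by
    rw [← Finset.add_sum_erase _ _ hmem] at hd
    linarith
  rw [div_eq_iff hij'] at hw
  have h : (∑ k ∈ Finset.range (n + 1), (dSj n k : ℚ) * (i k : ℚ)) + i j = dS n := by
    rw [← Finset.add_sum_erase _ _ hmem]
    linarith
  exact_mod_cast h

/-- If `n ≥ 1`, `0 ≤ i_k ≤ s_k − 1` for `0 ≤ k ≤ n`, `∑_{k=0}^{n} d_{n,k} i_k < d_n`,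
`i_j ≠ 0`, `w_j := (d_n − ∑_{k ≠ j} d_{n,k} i_k)/i_j`, and `∑_{k ≠ j} d_{n,k} + w_j = d_n`,
then `i_j = i_n` and `∑_{k=0}^{n−1} d_{n−1,k} i_k + i_n = d_{n−1}`. -/
theorem newton_weight_equality_case (n : ℕ) (hn : 1 ≤ n) (i : ℕ → ℕ)
    (hi : ∀ k, k ≤ n → i k ≤ syl k - 1)
    (hsum : ∑ k ∈ Finset.range (n + 1), dSj n k * i k < dS n)
    (j : ℕ) (hj : j ≤ n) (hij : i j ≠ 0)
    (wj : ℚ)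
    (hwj : wj = ((dS n : ℚ) -
        ∑ k ∈ (Finset.range (n + 1)).erase j, (dSj n k : ℚ) * (i k : ℚ)) / (i j : ℚ))
    (heq : (∑ k ∈ (Finset.range (n + 1)).erase j, (dSj n k : ℚ)) + wj = (dS n : ℚ)) :
    i j = i n ∧ (∑ k ∈ Finset.range n, dSj (n - 1) k * i k) + i n = dS (n - 1) := by
  obtain ⟨m, rfl⟩ : ∃ m, n = m + 1 := ⟨n - 1, by omega⟩
  rw [hwj] at heq
  have key := sum_dSj_mul_add_eq hj hij heq
  rw [sum_dSj_succ_mul, dS_succ] at key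
  have hs := syl_succ m
  have hlt : ∀ k ≤ m + 1, i k < syl (m + 1) := fun k hk => by
    have := hi k hk
    have := syl_mono hk
    have := syl_pos k
    omega
  have hmod : i j ≡ i (m + 1) [MOD syl (m + 1)] := by
    rw [← Int.natCast_modEq_iff, Int.modEq_iff_dvd]
    zify at key hs
    refine ⟨∑ k ∈ Finset.range (m + 1), (dSj m k : ℤ) * i k + i (m + 1) - dS m, ?_⟩
    linear_combination -key - (i (m + 1) : ℤ) * hs
  have hji : i j = i (m + 1) := hmod.eq_of_lt_of_lt (hlt j hj) (hlt _ le_rfl)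
  refine ⟨hji, Nat.eq_of_mul_eq_mul_left (syl_pos (m + 1)) ?_⟩
  rw [Nat.add_sub_cancel]
  rw [hji] at key
  zify at key hs ⊢
  linear_combination key + (i (m + 1) : ℤ) * hs
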